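/- Let (A,·) be an anti-flexible algebra and N : A → A a Nijenhuis operator. Then the deformed product a ·_N b = N(a)·b + a·N(b) − N(a·b) makes A an anti-flexible algebra, and N is an algebra homomorphism from (A, ·_N) to (A, ·), i.e. N(a ·_N b) = N(a)·N(b) for all a, b ∈ A. -/

import Mathlib

/-- The anti-flexible identity for a (bilinear) product. -/
def AntiFlexible {A : Type*} [AddCommGroup A] (mul : A → A → A) : Prop :=
  ∀ a b c : A, mul (mul a b) c - mul a (mul b c) = mul (mul c b) a - mul c (mul b a)

/-- Nijenhuis operator on `(A, mul)`. -/
def IsNijenhuis {A : Type*} [AddCommGroup A] (mul : A → A → A) (N : A → A) : Prop :=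
  ∀ a b : A, mul (N a) (N b) = N (mul (N a) b + mul a (N b) - N (mul a b))

/-- The associator of the deformed product, in terms of the original product. -/
theorem IsNijenhuis.deformed_associator {K A : Type*} [Field K] [AddCommGroup A] [Module K A]
    {mul : A →ₗ[K] A →ₗ[K] A} {N : A →ₗ[K] A} (hN : IsNijenhuis (fun a b => mul a b) N)
    {d : A → A → A} (hd : ∀ a b, d a b = mul (N a) b + mul a (N b) - N (mul a b)) (a b c : A) :
    d (d a b) c - d a (d b c) =
      (mul (mul (N a) (N b)) c - mul (N a) (mul (N b) c)) +
      (mul (mul (N a) b) (N c) - mul (N a) (mul b (N c))) +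
      (mul (mul a (N b)) (N c) - mul a (mul (N b) (N c))) -
      N ((mul (mul (N a) b) c - mul (N a) (mul b c)) +
        (mul (mul a (N b)) c - mul a (mul (N b) c)) +
        (mul (mul a b) (N c) - mul a (mul b (N c)))) +
      N (N (mul (mul a b) c - mul a (mul b c))) := by
  have hNd : ∀ x y, N (d x y) = mul (N x) (N y) := fun x y => by rw [hd]; exact (hN x y).symm
  have hl := hN (mul a b) c
  have hr := hN a (mul b c)
  rw [hd (d a b), hd a (d b c), hNd, hNd, hd a b, hd b c]
  simp only [map_add, map_sub, LinearMap.add_apply, LinearMap.sub_apply] at hl hr ⊢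
  rw [hl, hr]
  abel

/-- for a Nijenhuis operator `N` on an anti-flexible algebra `(A, ·)` the
deformed product `a ·_N b = N(a)·b + a·N(b) − N(a·b)` is anti-flexible, and `N` is an
algebra homomorphism from `(A, ·_N)` to `(A, ·)`. -/
theorem nijenhuis_deformed_antiflexible {K A : Type*} [Field K]
    [AddCommGroup A] [Module K A]
    (mul : A →ₗ[K] A →ₗ[K] A) (hA : AntiFlexible fun a b => mul a b)
    (N : A →ₗ[K] A) (hN : IsNijenhuis (fun a b => mul a b) N) :
    AntiFlexible (fun a b => mul (N a) b + mul a (N b) - N (mul a b)) ∧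
    (∀ a b : A, N (mul (N a) b + mul a (N b) - N (mul a b)) = mul (N a) (N b)) := by
  refine ⟨fun a b c => ?_, fun a b => (hN a b).symm⟩
  have h : ∀ x y z, mul (mul x y) z - mul x (mul y z) = mul (mul z y) x - mul z (mul y x) := hA
  have key := hN.deformed_associator
    (d := fun a b => mul (N a) b + mul a (N b) - N (mul a b)) (fun _ _ => rfl)
  refine (key a b c).trans (Eq.trans ?_ (key c b a).symm)
  rw [h (N a) (N b) c, h (N a) b (N c), h a (N b) (N c), h (N a) b c, h a (N b) c,
    h a b (N c), h a b c]
  simp only [map_add, map_sub]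
  abel
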